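/- Let p > 3 be prime, let θ : F_p → ℂ^* be a nontrivial additive character, let T be a multiplicative character of F_p with values in ℂ of order p−1 (a generator of the character group of F_p^*), and let a, b ∈ F_p^* with 4a³ + 27b² ≠ 0. Let E : y² = x³ + ax + b and a_p(E) := p − #{(x, y) ∈ F_p × F_p : y² = x³ + ax + b}. Then, as an identity in ℂ, a_p(E) = (−φ(b)·p/(p−1)) · [ 1 + (1/p) · Σ_{j=1}^{p−2} (g(T^{−j}) · g(T^{3j}) · g(T^{−4j}) / g(T^{−2j})) · T^{j}(16b²/a³) ]. -/

import Mathlib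

open Finset

/-- The quadratic character of a finite field, with values in `ℂ`. -/
noncomputable def complexQuadraticChar (F : Type*) [Field F] [Fintype F] [DecidableEq F] :
    MulChar F ℂ :=
  (quadraticChar F).ringHomComp (Int.castRingHom ℂ)

section FiniteField

variable {F : Type*} [Field F] [Fintype F]

lemma gaussSum_ne_zero {θ : AddChar F ℂ} (hθ : θ ≠ 1) (χ : MulChar F ℂ) : gaussSum χ θ ≠ 0 := by
  by_cases hχ : χ = 1
  · simp [hχ, gaussSum_one_left hθ]
  · exact gaussSum_ne_zero_of_nontrivial (by simp) hχ (AddChar.IsPrimitive.of_ne_one hθ)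

variable [DecidableEq F]

lemma complexQuadraticChar_apply (x : F) :
    complexQuadraticChar F x = (quadraticChar F x : ℂ) := rfl

lemma complexQuadraticChar_ne_one (hF : ringChar F ≠ 2) : complexQuadraticChar F ≠ 1 :=
  (MulChar.ringHomComp_ne_one_iff (Int.castRingHom ℂ).injective_int).2 (quadraticChar_ne_one hF)

lemma complexQuadraticChar_sq : complexQuadraticChar F ^ 2 = 1 :=
  (quadraticChar_isQuadratic F |>.comp (Int.castRingHom ℂ)).sq_eq_one

lemma complexQuadraticChar_inv : (complexQuadraticChar F)⁻¹ = complexQuadraticChar F :=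
  (quadraticChar_isQuadratic F |>.comp (Int.castRingHom ℂ)).inv

lemma complexQuadraticChar_mul_self_apply {x : F} (hx : x ≠ 0) :
    complexQuadraticChar F x * complexQuadraticChar F x = 1 := by
  rw [← MulChar.mul_apply, ← sq, complexQuadraticChar_sq, MulChar.one_apply hx.isUnit]

/-- A complex character of a finite field whose square is trivial is trivial or quadratic. -/
lemma MulChar.eq_one_or_eq_complexQuadraticChar (hF : ringChar F ≠ 2) {χ : MulChar F ℂ}
    (h : χ ^ 2 = 1) : χ = 1 ∨ χ = complexQuadraticChar F := by
  obtain ⟨g, hg⟩ := IsCyclic.exists_generator (α := Fˣ)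
  have key : ∀ ψ : MulChar F ℂ, ψ ^ 2 = 1 → ψ g = 1 ∨ ψ g = -1 := fun ψ hψ ↦ by
    rw [← sq_eq_one_iff, ← MulChar.pow_apply_coe, hψ, MulChar.one_apply_coe]
  rw [MulChar.eq_iff hg, MulChar.eq_iff hg, MulChar.one_apply_coe]
  have hne := complexQuadraticChar_ne_one hF
  rw [Ne, MulChar.eq_iff hg, MulChar.one_apply_coe] at hne
  rw [(key _ complexQuadraticChar_sq).resolve_left hne]
  exact key χ h

lemma sum_comp_sq (hF : ringChar F ≠ 2) (f : F → ℂ) :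
    ∑ u, f (u ^ 2) = ∑ v, (complexQuadraticChar F v + 1) * f v := by
  rw [← sum_fiberwise univ (fun u : F ↦ u ^ 2)]
  refine sum_congr rfl fun v _ ↦ ?_
  have h := quadraticChar_card_sqrts hF v
  rw [sum_congr rfl (g := fun _ ↦ f v) fun u hu ↦ by rw [(mem_filter.1 hu).2], sum_const,
    nsmul_eq_mul, complexQuadraticChar_apply]
  congr 1
  rw [Set.toFinset_ofPred] at h
  exact_mod_cast h

lemma card_sq_eq (hF : ringChar F ≠ 2) (f : F → F) :
    (#{xy : F × F | xy.2 ^ 2 = f xy.1} : ℂ) =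
      Fintype.card F + ∑ x, complexQuadraticChar F (f x) := by
  rw [card_filter, Nat.cast_sum, Fintype.sum_prod_type]
  have h (x : F) : ∑ y : F, (((if y ^ 2 = f x then 1 else 0 : ℕ)) : ℂ) =
      complexQuadraticChar F (f x) + 1 := by
    rw [sum_comp_sq hF (fun v ↦ (((if v = f x then 1 else 0 : ℕ)) : ℂ))]
    simp
  simp only [h, sum_add_distrib]
  simp [add_comm]

lemma jacobiSum_self (hF : ringChar F ≠ 2) {ψ : MulChar F ℂ} (hψ : ψ ≠ 1) :
    jacobiSum ψ ψ = ψ⁻¹ 4 * jacobiSum ψ (complexQuadraticChar F) := by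
  have h2 : (2 : F) ≠ 0 := Ring.two_ne_zero hF
  have hsum : ∑ v : F, ψ (1 - v) = 0 := by
    rw [← MulChar.sum_eq_zero_of_ne_one hψ]
    exact Equiv.sum_comp (Equiv.subLeft (1 : F)) ψ
  calc jacobiSum ψ ψ = ∑ u : F, ψ ((1 + u) / 2) * ψ (1 - (1 + u) / 2) :=
        (Equiv.sum_comp ((Equiv.addLeft (1 : F)).trans (Equiv.divRight₀ 2 h2))
          (fun x ↦ ψ x * ψ (1 - x))).symm
    _ = ∑ u : F, ψ⁻¹ 4 * ψ (1 - u ^ 2) := by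
        refine sum_congr rfl fun u _ ↦ ?_
        rw [MulChar.inv_apply', ← map_mul, ← map_mul]
        congr 1
        have h4 : (4 : F) = 2 * 2 := by norm_num
        rw [h4]
        field_simp
        ring
    _ = ψ⁻¹ 4 * ∑ v : F, (complexQuadraticChar F v + 1) * ψ (1 - v) := by
        rw [← mul_sum, sum_comp_sq hF (fun v ↦ ψ (1 - v))]
    _ = ψ⁻¹ 4 * jacobiSum ψ (complexQuadraticChar F) := by
        simp only [add_mul, sum_add_distrib, one_mul, hsum, add_zero]
        rw [jacobiSum_comm]
        rfl

/-- The Hasse–Davenport product formula for the quadratic character. -/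
theorem gaussSum_mul_gaussSum_mul_quadratic (hF : ringChar F ≠ 2) {θ : AddChar F ℂ} (hθ : θ ≠ 1)
    (ψ : MulChar F ℂ) :
    gaussSum ψ θ * gaussSum (ψ * complexQuadraticChar F) θ =
      ψ⁻¹ 4 * gaussSum (ψ ^ 2) θ * gaussSum (complexQuadraticChar F) θ := by
  have h2 : (2 : F) ≠ 0 := Ring.two_ne_zero hF
  have h4 : (4 : F) = 2 ^ 2 := by norm_num
  have h4' : (4 : F) ≠ 0 := h4 ▸ pow_ne_zero 2 h2
  by_cases h : ψ ^ 2 = 1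
  · obtain rfl | rfl := MulChar.eq_one_or_eq_complexQuadraticChar hF h
    · simp [MulChar.one_apply h4'.isUnit]
    · rw [complexQuadraticChar_inv, ← sq, complexQuadraticChar_sq, h4, map_pow, sq,
        complexQuadraticChar_mul_self_apply h2]
      ring
  · have hψ : ψ ≠ 1 := by rintro rfl; simp at h
    have hψφ : ψ * complexQuadraticChar F ≠ 1 := fun H ↦ h <| by
      rw [eq_inv_of_mul_eq_one_left H, complexQuadraticChar_inv, complexQuadraticChar_sq]
    have e1 := jacobiSum_mul_nontrivial (χ := ψ) (φ := ψ) (by rwa [← sq]) θ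
    have e2 := jacobiSum_mul_nontrivial hψφ θ
    rw [jacobiSum_self hF hψ, ← sq] at e1
    apply mul_left_cancel₀ (gaussSum_ne_zero hθ ψ)
    linear_combination (-gaussSum (ψ * complexQuadraticChar F) θ) * e1 +
      ψ⁻¹ 4 * gaussSum (ψ ^ 2) θ * e2

lemma gaussSum_quotient_eq (hF : ringChar F ≠ 2) {θ : AddChar F ℂ} (hθ : θ ≠ 1)
    (χ : MulChar F ℂ) (w : F) :
    gaussSum (χ ^ (-4 : ℤ)) θ / gaussSum (χ ^ (-2 : ℤ)) θ * χ (16 * w) =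
      gaussSum (χ ^ (-2 : ℤ) * complexQuadraticChar F) θ / gaussSum (complexQuadraticChar F) θ *
        χ w := by
  have h := gaussSum_mul_gaussSum_mul_quadratic hF hθ (χ ^ (-2 : ℤ))
  have h1 : (χ ^ (-2 : ℤ)) ^ 2 = χ ^ (-4 : ℤ) := by rw [← zpow_natCast, ← zpow_mul]; norm_num
  have h2 : (χ ^ (-2 : ℤ))⁻¹ 4 = χ 16 := by
    rw [← zpow_neg, neg_neg, zpow_ofNat, MulChar.pow_apply' _ two_ne_zero, ← map_pow]
    norm_num
  rw [h1, h2] at h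
  have e1 := gaussSum_ne_zero hθ (χ ^ (-2 : ℤ))
  have e2 := gaussSum_ne_zero hθ (complexQuadraticChar F)
  rw [map_mul]
  field_simp
  linear_combination (-χ w) * h

lemma sum_units_eq_sub (f : F → ℂ) : ∑ u : Fˣ, f u = ∑ x, f x - f 0 := by
  have h1 : ∑ u : Fˣ, f u = ∑ x : {x : F // x ≠ 0}, f x :=
    Fintype.sum_equiv unitsEquivNeZero _ _ fun _ ↦ rfl
  rw [h1, ← sum_subtype (univ.erase 0) (by simp) f, sum_erase_eq_sub (mem_univ _)]

lemma gaussSum_eq_sum_units (χ : MulChar F ℂ) (θ : AddChar F ℂ) :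
    gaussSum χ θ = ∑ u : Fˣ, χ u * θ u := by
  rw [sum_units_eq_sub (fun x ↦ χ x * θ x)]
  simp [gaussSum, MulChar.map_zero]

/-- Orthogonality for the powers of a generator of the character group. -/
lemma sum_pow_generator_apply {T : MulChar F ℂ} (hT : orderOf T = Fintype.card F - 1) (u : Fˣ) :
    ∑ j ∈ range (Fintype.card F - 1), (T ^ (j : ℤ)) (u : F) =
      if u = 1 then (Fintype.card F - 1 : ℂ) else 0 := by
  have hcard : Fintype.card Fˣ = Fintype.card F - 1 := Fintype.card_units F
  simp only [zpow_natCast, MulChar.pow_apply_coe]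
  split_ifs with hu
  · simp [hu, Nat.cast_sub Fintype.card_pos]
  · have hTu : T u ≠ 1 := fun H ↦ hu <| by
      obtain ⟨g, hg⟩ := IsCyclic.exists_generator (α := Fˣ)
      obtain ⟨k, rfl⟩ := (mem_powers_iff_mem_zpowers.2 (hg u))
      have : orderOf T ∣ k := by
        rw [orderOf_dvd_iff_pow_eq_one, MulChar.eq_iff hg, MulChar.pow_apply_coe,
          MulChar.one_apply_coe, ← map_pow]
        simpa using H
      simp only
      rw [← orderOf_dvd_iff_pow_eq_one, orderOf_eq_card_of_forall_mem_zpowers hg,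
        Nat.card_eq_fintype_card, hcard, ← hT]
      exact this
    rw [geom_sum_eq hTu, ← map_pow, ← hcard, ← Units.val_pow_eq_pow_val, pow_card_eq_one]
    simp

lemma sum_complexQuadraticChar_mul_addChar (hF : ringChar F ≠ 2) (θ : AddChar F ℂ) (c : F) :
    ∑ z : Fˣ, complexQuadraticChar F z * θ (z * c) =
      complexQuadraticChar F c * gaussSum (complexQuadraticChar F) θ := by
  rw [sum_units_eq_sub (fun z ↦ complexQuadraticChar F z * θ (z * c))]
  simp only [MulChar.map_zero, zero_mul, sub_zero]
  by_cases hc : c = 0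
  · simp [hc, MulChar.map_zero, MulChar.sum_eq_zero_of_ne_one (complexQuadraticChar_ne_one hF)]
  · have := gaussSum_mulShift_eq (complexQuadraticChar F) θ (Units.mk0 c hc)
    rw [complexQuadraticChar_inv] at this
    simpa [gaussSum, AddChar.mulShift_apply, mul_comm c] using this

/-- Summing a product of three Gauss sums over all characters. -/
lemma sum_gaussSum_mul (hF : ringChar F ≠ 2) (θ : AddChar F ℂ) {T : MulChar F ℂ}
    (hT : orderOf T = Fintype.card F - 1) (w : Fˣ) :
    ∑ j ∈ range (Fintype.card F - 1), gaussSum (T ^ (-(j : ℤ))) θ * gaussSum (T ^ (3 * (j : ℤ))) θ *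
      gaussSum (T ^ (-2 * (j : ℤ)) * complexQuadraticChar F) θ * (T ^ (j : ℤ)) w =
    (Fintype.card F - 1) * gaussSum (complexQuadraticChar F) θ *
      ∑ s : Fˣ, complexQuadraticChar F (s ^ 3 * w + s + 1) := by
  have expand (j : ℕ) : gaussSum (T ^ (-(j : ℤ))) θ * gaussSum (T ^ (3 * (j : ℤ))) θ *
      gaussSum (T ^ (-2 * (j : ℤ)) * complexQuadraticChar F) θ * (T ^ (j : ℤ)) w =
      ∑ z : Fˣ, ∑ y : Fˣ, ∑ x : Fˣ, complexQuadraticChar F z * θ (x + y + z) *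
        (T ^ (j : ℤ)) (x⁻¹ * (y ^ 3 * z⁻¹ ^ 2 * w) : Fˣ) := by
    have hz (m : ℤ) (x : Fˣ) : (T ^ (m * j)) (x : F) = (T ^ (j : ℤ)) ((x ^ m : Fˣ) : F) := by
      rw [mul_comm, zpow_mul, MulChar.zpow_apply_coe]
    rw [neg_eq_neg_one_mul (j : ℤ)]
    simp only [gaussSum_eq_sum_units, MulChar.mul_apply, hz]
    rw [show ∀ A B C W : ℂ, A * B * C * W = C * (B * (A * W)) from fun _ _ _ _ ↦ by ring]
    simp only [sum_mul]
    simp only [mul_sum]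
    refine sum_congr rfl fun z _ ↦ sum_congr rfl fun y _ ↦ sum_congr rfl fun x _ ↦ ?_
    rw [AddChar.map_add_eq_mul, AddChar.map_add_eq_mul]
    have e : z ^ (-2 : ℤ) = z⁻¹ ^ 2 := by simp [zpow_neg]
    rw [e]
    simp only [zpow_neg_one, zpow_ofNat, Units.val_mul, map_mul]
    ring
  simp only [expand]
  rw [sum_comm]
  have inner (z : Fˣ) : ∑ j ∈ range (Fintype.card F - 1), ∑ y : Fˣ, ∑ x : Fˣ,
      complexQuadraticChar F z * θ (x + y + z) *
        (T ^ (j : ℤ)) (x⁻¹ * (y ^ 3 * z⁻¹ ^ 2 * w) : Fˣ) =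
      ∑ s : Fˣ, (Fintype.card F - 1) *
        (complexQuadraticChar F z * θ (z * (s ^ 3 * w + s + 1))) := by
    rw [sum_comm, ← Equiv.sum_comp (Equiv.mulLeft z)]
    refine sum_congr rfl fun s _ ↦ ?_
    rw [sum_comm]
    simp only [← mul_sum, sum_pow_generator_apply hT, inv_mul_eq_one]
    simp only [mul_ite, mul_zero, sum_ite_eq', mem_univ, if_true]
    rw [mul_comm]
    congr 3
    simp only [Equiv.coe_mulLeft, Units.val_mul, Units.val_pow_eq_pow_val, Units.val_inv_eq_inv_val]
    have := z.ne_zero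
    field_simp
  simp only [inner]
  rw [sum_comm]
  simp only [← mul_sum, sum_complexQuadraticChar_mul_addChar hF, ← sum_mul]
  ring

end FiniteField

/-- **Formula (4.5)**: for a prime `p > 3`, a nontrivial additive character `θ`, a generator
`T` of the character group of `𝔽_p^*`, and an elliptic curve `E : y² = x³ + ax + b` over `𝔽_p`,
`a_p(E) = (-φ(b)p/(p-1))·[1 + (1/p)·Σ_{j=1}^{p-2}
          (g(T^{-j})g(T^{3j})g(T^{-4j})/g(T^{-2j}))·T^{j}(16b²/a³)]`. -/
theorem trace_eq_gauss_sum_quotient (p : ℕ) [Fact p.Prime] (hp3 : 3 < p)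
    (θ : AddChar (ZMod p) ℂ) (hθ : θ ≠ 1)
    (T : MulChar (ZMod p) ℂ) (hT : orderOf T = p - 1)
    (a b : ZMod p) (ha : a ≠ 0) (hb : b ≠ 0) (hns : 4 * a ^ 3 + 27 * b ^ 2 ≠ 0) :
    ((p : ℂ) -
        ((Finset.univ.filter
          (fun xy : ZMod p × ZMod p => xy.2 ^ 2 = xy.1 ^ 3 + a * xy.1 + b)).card : ℂ)) =
      (-(quadraticChar (ZMod p) b : ℂ) * (p : ℂ) / ((p : ℂ) - 1)) *
        (1 + (1 / (p : ℂ)) *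
          ∑ j ∈ Finset.Ico 1 (p - 1),
            gaussSum (T ^ (-(j : ℤ))) θ * gaussSum (T ^ (3 * (j : ℤ))) θ *
                gaussSum (T ^ (-4 * (j : ℤ))) θ / gaussSum (T ^ (-2 * (j : ℤ))) θ *
              (T ^ (j : ℤ)) (16 * b ^ 2 / a ^ 3)) := by
  have hF : ringChar (ZMod p) ≠ 2 := by rw [ZMod.ringChar_zmod_n]; omega
  have hcard : Fintype.card (ZMod p) = p := ZMod.card p
  have hp : (p : ℂ) ≠ 0 := Nat.cast_ne_zero.2 (by omega)
  have hp1 : (p : ℂ) - 1 ≠ 0 := sub_ne_zero.2 (Nat.cast_ne_one.2 (by omega))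
  have hφ := complexQuadraticChar_mul_self_apply hb
  have hb2 : b ^ 2 / a ^ 3 ≠ 0 := div_ne_zero (pow_ne_zero 2 hb) (pow_ne_zero 3 ha)
  have hg := gaussSum_ne_zero hθ (complexQuadraticChar (ZMod p))
  have key := sum_gaussSum_mul hF θ (T := T) (by rw [hT, hcard]) (Units.mk0 _ hb2)
  have hsum : ∑ s : (ZMod p)ˣ, complexQuadraticChar (ZMod p) (s ^ 3 * (b ^ 2 / a ^ 3) + s + 1) =
      complexQuadraticChar (ZMod p) b *
        ∑ x, complexQuadraticChar (ZMod p) (x ^ 3 + a * x + b) - 1 := by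
    have h0 := sum_units_eq_sub fun x ↦ complexQuadraticChar (ZMod p) (x ^ 3 + a * x + b)
    rw [show (0 : ZMod p) ^ 3 + a * 0 + b = b by ring] at h0
    rw [← hφ, ← mul_sub, ← h0, mul_sum,
      ← Equiv.sum_comp (Equiv.mulLeft (Units.mk0 (a / b) (div_ne_zero ha hb)))]
    refine sum_congr rfl fun x _ ↦ ?_
    simp only [Equiv.coe_mulLeft, Units.val_mul, Units.val_mk0]
    have hx : (x : ZMod p) ^ 3 + a * x + b =
        b * ((a / b * x) ^ 3 * (b ^ 2 / a ^ 3) + a / b * x + 1) := by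
      field_simp
    rw [hx, map_mul, ← mul_assoc, hφ, one_mul]
  rw [card_sq_eq hF (fun x ↦ x ^ 3 + a * x + b), hcard, ← complexQuadraticChar_apply]
  rw [hcard] at key
  simp only [Units.val_mk0] at key
  rw [hsum] at key
  have hterm (j : ℕ) : gaussSum (T ^ (-(j : ℤ))) θ * gaussSum (T ^ (3 * (j : ℤ))) θ *
                gaussSum (T ^ (-4 * (j : ℤ))) θ / gaussSum (T ^ (-2 * (j : ℤ))) θ *
              (T ^ (j : ℤ)) (16 * b ^ 2 / a ^ 3) =
      gaussSum (T ^ (-(j : ℤ))) θ * gaussSum (T ^ (3 * (j : ℤ))) θ *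
      gaussSum (T ^ (-2 * (j : ℤ)) * complexQuadraticChar (ZMod p)) θ *
        (T ^ (j : ℤ)) (b ^ 2 / a ^ 3) / gaussSum (complexQuadraticChar (ZMod p)) θ := by
    have h := gaussSum_quotient_eq hF hθ (T ^ (j : ℤ)) (b ^ 2 / a ^ 3)
    rw [← zpow_mul, ← zpow_mul, mul_comm (j : ℤ), mul_comm (j : ℤ)] at h
    rw [mul_div_assoc 16]
    linear_combination gaussSum (T ^ (-(j : ℤ))) θ * gaussSum (T ^ (3 * (j : ℤ))) θ * h
  simp only [hterm]
  rw [← sum_div]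
  rw [range_eq_Ico, sum_eq_sum_Ico_succ_bot (by omega)] at key
  simp only [Nat.cast_zero, mul_zero, neg_zero, zpow_zero, one_mul, gaussSum_one_left hθ,
    MulChar.one_apply hb2.isUnit, zero_add] at key
  rw [eq_sub_of_add_eq' key]
  generalize ∑ x, complexQuadraticChar (ZMod p) (x ^ 3 + a * x + b) = S
  field_simp
  linear_combination ((p : ℂ) - 1) * S * hφ
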